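/- Let G be a connected δ-hyperbolic graph (δ ≥ 1/2), let p and q be two nodes with β = dist_G(p,q) > 6, and let p', q' be nodes on a fixed shortest path between p and q with dist_G(p,p') = dist_G(p',q') = dist_G(q',q) = β/3. Let 0 < α < 1/4 with α·β an integer, and let C = { u ∈ V : ∃ v on the chosen shortest p'–q' subpath with dist_G(u,v) = α·β − 1 }. Then the distance between p and q in the graph G_{−C} obtained by deleting the nodes of C satisfies dist_{G_{−C}}(p,q) ≥ (β/60)·2^{α·β/δ}. -/

import Mathlib

open scoped Classical
open Real

namespace PaperHyp

/-- Four-point condition for Gromov δ-hyperbolicity. -/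
def IsHyp {V : Type*} (G : SimpleGraph V) (δ : ℝ) : Prop :=
  ∀ u₁ u₂ u₃ u₄ : V,
    let s₁ : ℝ := G.dist u₁ u₂ + G.dist u₃ u₄
    let s₂ : ℝ := G.dist u₁ u₃ + G.dist u₂ u₄
    let s₃ : ℝ := G.dist u₁ u₄ + G.dist u₂ u₃
    max s₁ (max s₂ s₃) - (s₁ + s₂ + s₃ - max s₁ (max s₂ s₃) - min s₁ (min s₂ s₃)) ≤ 2 * δ

/-- Twice the Gromov product of `x` and `y` based at `v`. -/
noncomputable def gromovProd {V : Type*} (G : SimpleGraph V) (v x y : V) : ℤ :=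
  G.dist x v + G.dist y v - G.dist x y

theorem IsHyp.min_gromovProd_le {V : Type*} {G : SimpleGraph V} {δ : ℝ} (h : IsHyp G δ)
    (v x y z : V) :
    min (gromovProd G v x y) (gromovProd G v y z) - ⌊2 * δ⌋ ≤ gromovProd G v x z := by
  by_contra! hlt
  have hx : gromovProd G v x z + ⌊2 * δ⌋ + 1 ≤ gromovProd G v x y :=
    by have := min_le_left (gromovProd G v x y) (gromovProd G v y z); omega
  have hz : gromovProd G v x z + ⌊2 * δ⌋ + 1 ≤ gromovProd G v y z :=
    by have := min_le_right (gromovProd G v x y) (gromovProd G v y z); omega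
  have hfl := Int.lt_floor_add_one (2 * δ)
  have hq := h v y x z
  have hxR : ((gromovProd G v x z + ⌊2 * δ⌋ + 1 : ℤ) : ℝ) ≤ (gromovProd G v x y : ℤ) := by
    exact_mod_cast hx
  have hzR : ((gromovProd G v x z + ⌊2 * δ⌋ + 1 : ℤ) : ℝ) ≤ (gromovProd G v y z : ℤ) := by
    exact_mod_cast hz
  simp only [gromovProd, G.dist_comm (u := v)] at hq hxR hzR
  push_cast at hxR hzR
  rw [G.dist_comm (u := y) (v := x)] at hq
  rcases max_cases (G.dist x v + G.dist y z : ℝ) (G.dist z v + G.dist x y) with ⟨e, _⟩ | ⟨e, _⟩ <;>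
  rcases min_cases (G.dist x v + G.dist y z : ℝ) (G.dist z v + G.dist x y) with ⟨e', _⟩ | ⟨e', _⟩ <;>
  rw [e, e'] at hq <;>
  rcases max_cases (G.dist y v + G.dist x z : ℝ) _ with ⟨e, _⟩ | ⟨e, _⟩ <;>
  rw [e] at hq <;>
  rcases min_cases (G.dist y v + G.dist x z : ℝ) _ with ⟨e, _⟩ | ⟨e, _⟩ <;>
  rw [e] at hq <;> linarith

theorem gromovProd_nonneg {V : Type*} {G : SimpleGraph V} (hG : G.Connected) (v x y : V) :
    0 ≤ gromovProd G v x y := by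
  have := hG.dist_triangle (u := x) (v := v) (w := y)
  rw [G.dist_comm (u := v)] at this
  unfold gromovProd
  omega

/-- Recursive halving: in a sequence where nearby terms have large product, `2 ^ n` blocks cost
at most `n` applications of the ultrametric-type inequality. -/
theorem dyadic_le {P : ℕ → ℕ → ℤ} {D M : ℤ} {s : ℕ}
    (hP : ∀ i j l, min (P i j) (P j l) - D ≤ P i l)
    (hloc : ∀ i j, i ≤ j → M - ((j - i : ℕ) : ℤ) ≤ P i j) (n : ℕ) :
    ∀ i j, i ≤ j → j - i ≤ s * 2 ^ n → M - s - D * n ≤ P i j := by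
  induction n with
  | zero =>
    intro i j hij hle
    have := hloc i j hij
    simp only [pow_zero, mul_one] at hle
    push_cast
    omega
  | succ n ih =>
    intro i j hij hle
    rw [pow_succ] at hle
    set t := s * 2 ^ n with ht
    have hle' : j - i ≤ 2 * t := by rw [ht]; linarith
    have h₁ := ih i (i + min t (j - i)) (by omega) (by omega)
    have h₂ := ih (i + min t (j - i)) j (by omega) (by omega)
    have h₃ := hP i (i + min t (j - i)) j
    have h₄ := le_min h₁ h₂
    push_cast
    linarith

/-- If the product of the end terms vanishes but the products at both ends start out large, then
the transition between the two ends takes exponentially many steps. -/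
theorem exists_long_gap {P : ℕ → ℕ → ℤ} {D M : ℤ} {s n L : ℕ}
    (hP : ∀ i j l, min (P i j) (P j l) - D ≤ P i l)
    (hloc : ∀ i j, i ≤ j → M - ((j - i : ℕ) : ℤ) ≤ P i j)
    (hM : D * (n + 3 : ℕ) + s + 1 ≤ M)
    (hends : P 0 L ≤ 0) (hleft : 2 * D + 1 ≤ P 0 0) (hright : 3 * D + 1 ≤ P L L) :
    ∃ a b, b ≤ L ∧ 5 * s * 2 ^ n < b - a ∧
      ∀ i, a < i → i < b → P 0 i ≤ 2 * D ∧ P i L ≤ 3 * D := by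
  have hex : ∃ b, 3 * D + 1 ≤ P b L := ⟨L, hright⟩
  set b := Nat.find hex with hb
  have hbs : 3 * D + 1 ≤ P b L := Nat.find_spec hex
  set a := Nat.findGreatest (fun i => 2 * D + 1 ≤ P 0 i) b with ha
  have has : 2 * D + 1 ≤ P 0 a :=
    Nat.findGreatest_spec (P := fun i => 2 * D + 1 ≤ P 0 i) (Nat.zero_le b) hleft
  have hab : a ≤ b := Nat.findGreatest_le b
  refine ⟨a, b, Nat.find_min' hex hright, ?_, fun i hai hib => ⟨?_, ?_⟩⟩
  · by_contra! hle
    set t := s * 2 ^ n with ht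
    have hle' : b - a ≤ 5 * t := by rw [ht]; linarith
    have e : s * 2 ^ (n + 1) = 2 * t := by rw [ht]; ring
    set c := a + min (2 * t) (b - a) with hc
    set d := c + min (2 * t) (b - c) with hd
    have h₁ := dyadic_le (s := s) hP hloc (n + 1) a c (by omega) (by omega)
    have h₂ := dyadic_le (s := s) hP hloc (n + 1) c d (by omega) (by omega)
    have h₃ := dyadic_le (s := s) hP hloc n d b (by omega) (by omega)
    push_cast at h₁ h₂ h₃ hM
    have k₁ := hP d b L
    have k₂ := hP c d L
    have k₃ := hP 0 a c
    have k₄ := hP 0 c L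
    have l₁ : 3 * D + 1 ≤ min (P d b) (P b L) := le_min (by linarith) hbs
    have l₂ : 2 * D + 1 ≤ min (P c d) (P d L) := le_min (by linarith) (by linarith)
    have l₃ : 2 * D + 1 ≤ min (P 0 a) (P a c) := le_min has (by linarith)
    have l₄ : D + 1 ≤ min (P 0 c) (P c L) := le_min (by linarith) (by linarith)
    linarith
  · have := Nat.findGreatest_is_greatest (P := fun i => 2 * D + 1 ≤ P 0 i) hai hib.le
    omega
  · have := Nat.find_min hex hib
    omega

theorem dist_getVert_le {V : Type*} {G : SimpleGraph V} (hG : G.Connected) {p q : V}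
    (z : G.Walk p q) {i j : ℕ} (hij : i ≤ j) :
    G.dist (z.getVert i) (z.getVert j) ≤ j - i := by
  induction j, hij using Nat.le_induction with
  | base => simp
  | succ j hij ih =>
    have h₁ : G.dist (z.getVert j) (z.getVert (j + 1)) ≤ 1 := by
      by_cases hj : j < z.length
      · exact (SimpleGraph.dist_eq_one_iff_adj.2 (z.adj_getVert_succ hj)).le
      · rw [z.getVert_of_length_le (by omega), z.getVert_of_length_le (by omega)]
        simp
    have := hG.dist_triangle (u := z.getVert i) (v := z.getVert j) (w := z.getVert (j + 1))
    omega

/-- A walk starting farther than `K - 1` from `v` and never at distance exactly `K - 1` stays at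
distance at least `K`. -/
theorem le_dist_getVert {V : Type*} {G : SimpleGraph V} (hG : G.Connected) {p q v : V}
    (z : G.Walk p q) {K : ℕ} (hp : K ≤ G.dist p v)
    (hz : ∀ x ∈ z.support, G.dist x v + 1 ≠ K) (i : ℕ) : K ≤ G.dist (z.getVert i) v := by
  induction i with
  | zero => simpa using hp
  | succ i ih =>
    have h₁ := dist_getVert_le hG z (Nat.le_succ i)
    have h₂ := hG.dist_triangle (u := z.getVert i) (v := z.getVert (i + 1)) (w := v)
    have h₃ := hz _ (z.getVert_mem_support (i + 1))
    simp only [Nat.succ_eq_add_one] at h₁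
    omega

/-- Integers `t` with `2 t` in an interval of length `N`. -/
theorem card_filter_two_mul_le (m N : ℕ) (c : ℤ) (p : ℕ → Prop) [DecidablePred p]
    (hp : ∀ t, t ≤ m → p t → c ≤ 2 * t ∧ 2 * (t : ℤ) ≤ c + N) :
    ((Finset.range (m + 1)).filter p).card ≤ N / 2 + 1 := by
  set S := (Finset.range (m + 1)).filter p with hS
  rcases S.eq_empty_or_nonempty with h | h
  · simp [h]
  · have hmem : ∀ t ∈ S, c ≤ 2 * t ∧ 2 * (t : ℤ) ≤ c + N := fun t ht => by
      rw [hS, Finset.mem_filter, Finset.mem_range] at ht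
      exact hp t (by omega) ht.2
    have hsub : S ⊆ Finset.Icc (S.min' h) (S.min' h + N / 2) := fun t ht => by
      have h₁ := hmem t ht
      have h₂ := hmem _ (S.min'_mem h)
      have h₃ := S.min'_le t ht
      rw [Finset.mem_Icc]
      omega
    have := Finset.card_le_card hsub
    rw [Nat.card_Icc] at this
    omega

theorem two_mul_count_mul_rpow_le {D s : ℕ} (hD : 1 ≤ D) (hs : D ≤ s) (hs' : s + 1 ≤ 2 * D) :
    2 * ((5 * D / 2 + 1 : ℕ) : ℝ) * (2 : ℝ) ^ (((s : ℝ) + 1) / D) ≤ 25 * s := by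
  rcases hD.eq_or_lt with rfl | hD2
  · obtain rfl : s = 1 := by omega
    norm_num
  · have hDR : (2 : ℝ) ≤ D := by exact_mod_cast hD2
    have hsR : (D : ℝ) ≤ s := by exact_mod_cast hs
    have hs'R : (s : ℝ) + 1 ≤ 2 * D := by exact_mod_cast hs'
    have hD0 : (0 : ℝ) < D := by linarith
    have hE : (2 : ℝ) ^ (((s : ℝ) + 1) / D) ≤ 2 * (((s : ℝ) + 1) / D) := by
      have hb := rpow_one_add_le_one_add_mul_self (s := 1) (by norm_num)
        (p := ((s : ℝ) + 1) / D - 1)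
        (by rw [sub_nonneg, le_div_iff₀ hD0]; linarith)
        (by rw [sub_le_iff_le_add, div_le_iff₀ hD0]; linarith)
      rw [show (1 : ℝ) + 1 = 2 by norm_num, Real.rpow_sub_one (by norm_num)] at hb
      linarith
    have hc : 2 * ((5 * D / 2 + 1 : ℕ) : ℝ) ≤ 5 * D + 2 := by
      have : 2 * (5 * D / 2 + 1) ≤ 5 * D + 2 := by omega
      exact_mod_cast this
    calc _ ≤ (5 * D + 2) * (2 * (((s : ℝ) + 1) / D)) := by gcongr
      _ ≤ 25 * s := by
        rw [← mul_div_assoc, ← mul_div_assoc, div_le_iff₀ hD0]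
        nlinarith

/-- Cylinder removal around a geodesic: deleting the nodes at distance exactly αβ − 1 from the
middle third of a p–q geodesic makes every surviving p–q path exponentially long.  A path in the
node-deleted graph `G₋C` is a walk of `G` all whose support avoids `C`. -/
theorem cylinder_removal (V : Type) [Fintype V] (G : SimpleGraph V) (δ α : ℝ) (p q p' q' : V)
    (w : G.Walk p q) (w' : G.Walk p' q') (C : Set V)
    (hconn : G.Connected) (hδ : (1 / 2 : ℝ) ≤ δ) (hhyp : IsHyp G δ)
    (hβ : 6 < G.dist p q)
    (hgeo : w.length = G.dist p q)
    (hp' : p' ∈ w.support) (hq' : q' ∈ w.support)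
    (h1 : 3 * G.dist p p' = G.dist p q)
    (h2 : 3 * G.dist p' q' = G.dist p q)
    (h3 : 3 * G.dist q' q = G.dist p q)
    (hα0 : 0 < α) (hα1 : α < 1 / 4)
    (hαint : ∃ k : ℕ, (k : ℝ) = α * G.dist p q)
    (hgeo' : w'.length = G.dist p' q')
    (hC : C = {u : V | ∃ v ∈ w'.support, (G.dist u v : ℝ) = α * G.dist p q - 1}) :
    ∀ z : G.Walk p q, (∀ x ∈ z.support, x ∉ C) →
      ((G.dist p q : ℝ) / 60) * (2 : ℝ) ^ (α * (G.dist p q : ℝ) / δ) ≤ (z.length : ℝ) := by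
  intro z hz
  obtain ⟨K, hK⟩ := hαint
  have hβR : (6 : ℝ) < G.dist p q := by exact_mod_cast hβ
  have hlen : G.dist p q ≤ z.length := SimpleGraph.dist_le z
  have hlenR : (G.dist p q : ℝ) ≤ z.length := by exact_mod_cast hlen
  rw [← hK] at hC ⊢
  have hKpos : 1 ≤ K := by
    have : (0 : ℝ) < K := by rw [hK]; positivity
    exact_mod_cast this
  have hK4 : 4 * K < G.dist p q := by
    have : (4 : ℝ) * K < G.dist p q := by rw [hK]; nlinarith
    exact_mod_cast this
  obtain ⟨D, hDfl⟩ : ∃ D : ℕ, ⌊2 * δ⌋ = D :=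
    Int.eq_ofNat_of_zero_le (Int.floor_nonneg.2 (by linarith))
  have hD1 : 1 ≤ D := by
    have : (1 : ℤ) ≤ ⌊2 * δ⌋ := Int.le_floor.2 (by push_cast; linarith)
    omega
  have hD2δ : (D : ℝ) ≤ 2 * δ := by
    have := Int.floor_le (2 * δ)
    rw [hDfl] at this
    exact_mod_cast this
  have hD0 : (0 : ℝ) < D := by exact_mod_cast hD1
  have hexp : (2 : ℝ) ^ ((K : ℝ) / δ) ≤ 2 ^ (2 * (K : ℝ) / D) := by
    apply Real.rpow_le_rpow_of_exponent_le (by norm_num)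
    rw [div_le_div_iff₀ (by linarith) hD0]
    nlinarith [(Nat.cast_nonneg K : (0 : ℝ) ≤ K)]
  refine (mul_le_mul_of_nonneg_left hexp (by positivity)).trans ?_
  rcases le_or_gt (2 * K) (5 * D) with hsmall | hbig
  · have : (2 : ℝ) ^ (2 * (K : ℝ) / D) ≤ 2 ^ (5 : ℝ) := by
      apply Real.rpow_le_rpow_of_exponent_le (by norm_num)
      rw [div_le_iff₀ hD0]
      exact_mod_cast hsmall
    norm_num at this
    nlinarith
  obtain ⟨m, hm⟩ : ∃ m, m = G.dist p p' := ⟨_, rfl⟩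
  have hw'len : w'.length = m := by omega
  -- Positions of the vertices of the middle segment.
  have hpos : ∀ t, t ≤ m →
      G.dist p (w'.getVert t) = m + t ∧ G.dist q (w'.getVert t) = 2 * m - t := by
    intro t ht
    have a₁ := dist_getVert_le hconn w' (Nat.zero_le t)
    have a₂ := dist_getVert_le hconn w' (hw'len ▸ ht)
    rw [w'.getVert_zero] at a₁
    rw [w'.getVert_length] at a₂
    have a₃ := hconn.dist_triangle (u := p) (v := p') (w := w'.getVert t)
    have a₄ := hconn.dist_triangle (u := w'.getVert t) (v := q') (w := q)
    have a₅ := hconn.dist_triangle (u := p) (v := w'.getVert t) (w := q)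
    rw [G.dist_comm (u := q)]
    omega
  have hfar : ∀ t, t ≤ m → ∀ i, K ≤ G.dist (z.getVert i) (w'.getVert t) := by
    intro t ht
    refine le_dist_getVert hconn z (by have := hpos t ht; omega) fun x hx hxK => hz x hx ?_
    rw [hC]
    refine ⟨_, w'.getVert_mem_support t, ?_⟩
    rw [← hxK]
    push_cast
    ring
  obtain ⟨n, s, hs, hs', hns⟩ : ∃ n s, D ≤ s ∧ s + 1 ≤ 2 * D ∧ 2 * K = D * (n + 3) + s + 1 := by
    have h₁ := Nat.div_add_mod (2 * K - 1) D
    have h₂ := Nat.mod_lt (2 * K - 1) (show 0 < D by omega)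
    have h₃ : 4 ≤ (2 * K - 1) / D := (Nat.le_div_iff_mul_le (by omega)).2 (by omega)
    obtain ⟨r, hr⟩ := Nat.exists_eq_add_of_le h₃
    refine ⟨r, D + (2 * K - 1) % D, by omega, by omega, ?_⟩
    rw [hr] at h₁
    have : D * (4 + r) = D * (r + 3) + D := by ring
    omega
  set R : ℕ → ℕ → Prop := fun t i =>
    gromovProd G (w'.getVert t) p (z.getVert i) ≤ 2 * D ∧
      gromovProd G (w'.getVert t) (z.getVert i) q ≤ 3 * D with hR
  have hmany : ∀ t ∈ Finset.range (m + 1),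
      5 * s * 2 ^ n ≤ ((Finset.range z.length).filter (R t)).card := by
    intro t ht
    rw [Finset.mem_range] at ht
    have htm : t ≤ m := by omega
    have hd := hpos t htm
    obtain ⟨a, b, hb, hab, hmid⟩ := exists_long_gap
      (P := fun i j => gromovProd G (w'.getVert t) (z.getVert i) (z.getVert j))
      (D := D) (M := 2 * K) (s := s) (n := n) (L := z.length)
      (fun i j l => by
        have := hhyp.min_gromovProd_le (w'.getVert t) (z.getVert i) (z.getVert j) (z.getVert l)
        rwa [hDfl] at this)
      (fun i j hij => by
        have b₁ := dist_getVert_le hconn z hij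
        have b₂ := hfar t htm i
        have b₃ := hfar t htm j
        simp only [gromovProd]
        omega)
      (by exact_mod_cast hns.ge)
      (by simp only [gromovProd, z.getVert_zero, z.getVert_length]; omega)
      (by simp only [gromovProd, z.getVert_zero, SimpleGraph.dist_self]; omega)
      (by simp only [gromovProd, z.getVert_length, SimpleGraph.dist_self]; omega)
    simp only [z.getVert_zero, z.getVert_length] at hmid
    have hsub : Finset.Ioo a b ⊆ (Finset.range z.length).filter (R t) := fun i hi => by
      rw [Finset.mem_Ioo] at hi
      rw [Finset.mem_filter, Finset.mem_range]
      exact ⟨by omega, hmid i hi.1 hi.2⟩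
    have := Finset.card_le_card hsub
    rw [Nat.card_Ioo] at this
    omega
  have hfew : ∀ i ∈ Finset.range z.length,
      ((Finset.range (m + 1)).filter fun t => R t i).card ≤ 5 * D / 2 + 1 := by
    intro i _
    refine card_filter_two_mul_le m (5 * D)
      (m - 3 * D + G.dist p (z.getVert i) - G.dist (z.getVert i) q) _ fun t ht hRt => ?_
    have hd := hpos t ht
    have c₁ := gromovProd_nonneg hconn (w'.getVert t) p (z.getVert i)
    have c₂ := gromovProd_nonneg hconn (w'.getVert t) (z.getVert i) q
    simp only [hR, gromovProd] at hRt c₁ c₂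
    omega
  have hcount : (m + 1) * (5 * s * 2 ^ n) ≤ z.length * (5 * D / 2 + 1) := by
    have h₁ := Finset.card_nsmul_le_sum _ _ _ hmany
    have h₂ := Finset.sum_le_card_nsmul _ _ _ hfew
    have h₃ := Finset.sum_card_bipartiteAbove_eq_sum_card_bipartiteBelow
      (s := Finset.range (m + 1)) (t := Finset.range z.length) R
    simp only [Finset.bipartiteAbove, Finset.bipartiteBelow] at h₃
    simp only [Finset.card_range, smul_eq_mul] at h₁ h₂
    exact h₁.trans (h₃.le.trans h₂)
  have hcountR : ((m : ℝ) + 1) * (5 * s * 2 ^ n) ≤ z.length * ((5 * D / 2 + 1 : ℕ) : ℝ) := by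
    exact_mod_cast hcount
  have hβm : (G.dist p q : ℝ) = 3 * m := by
    have : G.dist p q = 3 * m := by omega
    exact_mod_cast this
  have hsplit : (2 : ℝ) ^ (2 * (K : ℝ) / D) = 8 * 2 ^ n * 2 ^ (((s : ℝ) + 1) / D) := by
    have h₁ : 2 * (K : ℝ) = D * (n + 3) + s + 1 := by exact_mod_cast hns
    have h₂ : 2 * (K : ℝ) / D = ((n + 3 : ℕ) : ℝ) + ((s : ℝ) + 1) / D := by
      rw [h₁]
      push_cast
      field_simp
      ring
    rw [h₂, Real.rpow_add (by norm_num), Real.rpow_natCast, pow_add]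
    ring
  have hE := two_mul_count_mul_rpow_le hD1 hs hs'
  rw [hβm, hsplit]
  set c : ℝ := ((5 * D / 2 + 1 : ℕ) : ℝ) with hc
  set E : ℝ := 2 ^ (((s : ℝ) + 1) / D)
  have hcpos : 0 < c := by rw [hc]; positivity
  refine le_of_mul_le_mul_right ?_ hcpos
  calc 3 * (m : ℝ) / 60 * (8 * 2 ^ n * E) * c = m * 2 ^ n / 5 * (2 * c * E) := by ring
    _ ≤ m * 2 ^ n / 5 * (25 * s) := by gcongr
    _ ≤ (m + 1) * (5 * s * 2 ^ n) := by
      have : (0 : ℝ) ≤ 5 * s * 2 ^ n := by positivity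
      linarith
    _ ≤ _ := hcountR

end PaperHyp
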